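/- arXiv:0810.3030 — 4 statements merged into one kernel-verified Lean document; each statement's English description precedes it below -/
import Mathlib

section
/- Let G be an abelian group, H a subgroup of G, and |·|_H a pseudonorm on H. Then there exists a pseudonorm |·|_G on G extending |·|_H (i.e. |x|_G = |x|_H for all x ∈ H) such that for every infinite cardinal κ, the pseudometric space (H, d_H) with d_H(x,y) = |x−y|_H has a dense subset of cardinality ≤ κ if and only if the pseudometric space (G, d_G) with d_G(x,y) = |x−y|_G has a dense subset of cardinality ≤ κ (i.e. the densities of the two pseudometrizable topological groups coincide). -/
open UniformSpace

/-- Cardinality bound for finitely supported functions. -/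
theorem card_finsupp_le {α : Type u} {β : Type} [Zero β] [Countable β] {κ : Cardinal.{u}}
    (hκ : Cardinal.aleph0 ≤ κ) (h : Cardinal.mk α ≤ κ) : Cardinal.mk (α →₀ β) ≤ κ := by
  classical
  have h1 : Cardinal.mk (α →₀ β) ≤ Cardinal.mk (Finset (α × β)) :=
    Cardinal.mk_le_of_injective (Finsupp.graph_injective α β)
  refine h1.trans ?_
  have hp : Cardinal.mk (α × β) ≤ κ := by
    rw [Cardinal.mk_prod]
    have hb : Cardinal.lift.{u} (Cardinal.mk β) ≤ κ := le_trans (by simp) hκ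
    have ha : Cardinal.lift.{0} (Cardinal.mk α) ≤ κ := by simpa using h
    exact (mul_le_mul' ha hb).trans (Cardinal.mul_eq_self hκ).le
  rcases finite_or_infinite (α × β) with hf | hi
  · exact (Cardinal.mk_le_aleph0).trans hκ
  · rw [Cardinal.mk_finset_of_infinite]; exact hp

/-- Density passes to subspaces. -/
theorem density_sub {X Y : Type u} (ι : X → Y) (d : Y → Y → ℝ) (hs : ∀ x y, d x y = d y x)
    (ht : ∀ x y z, d x z ≤ d x y + d y z) {κ : Cardinal.{u}} (hκ : Cardinal.aleph0 ≤ κ)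
    (D : Set Y) (hD : Cardinal.mk D ≤ κ) (hd : ∀ x, ∀ ε : ℝ, 0 < ε → ∃ y ∈ D, d x y < ε) :
    ∃ D' : Set X, Cardinal.mk D' ≤ κ ∧
      ∀ x, ∀ ε : ℝ, 0 < ε → ∃ y ∈ D', d (ι x) (ι y) < ε := by
  classical
  let S : Set (D × ℕ) := {p | ∃ x : X, d (ι x) p.1 < 1 / ((p.2 : ℝ) + 1)}
  let c : S → X := fun p => p.2.choose
  have hc : ∀ p : S, d (ι (c p)) p.1.1 < 1 / ((p.1.2 : ℝ) + 1) := fun p => p.2.choose_spec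
  refine ⟨Set.range c, ?_, ?_⟩
  · refine Cardinal.mk_range_le.trans ((Cardinal.mk_set_le S).trans ?_)
    rw [Cardinal.mk_prod]
    simp only [Cardinal.lift_uzero, Cardinal.mk_nat, Cardinal.lift_aleph0]
    calc _ ≤ κ * κ := by gcongr
      _ = κ := Cardinal.mul_eq_self hκ
  · intro x ε hε
    obtain ⟨n, hn⟩ := exists_nat_one_div_lt (half_pos hε)
    obtain ⟨y, hy, hxy⟩ := hd (ι x) (1 / ((n : ℝ) + 1)) (by positivity)
    let p : S := ⟨(⟨y, hy⟩, n), x, hxy⟩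
    refine ⟨c p, ⟨p, rfl⟩, ?_⟩
    have h1 := hc p
    have h2 := ht (ι x) y (ι (c p))
    rw [hs y] at h2
    change d (ι (c p)) y < 1 / ((n : ℝ) + 1) at h1
    linarith

/-- Weighted `ℓ¹` seminorm on finitely supported rational functions. -/
noncomputable def wnorm {A : Type u} [SeminormedAddCommGroup A] :
    AddGroupSeminorm (A →₀ ℚ) where
  toFun q := q.sum fun a c => |(c : ℝ)| * ‖a‖
  map_zero' := by simp
  add_le' x y := by
    classical
    have e : ∀ q : A →₀ ℚ, q.support ⊆ x.support ∪ y.support →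
        (q.sum fun a c => |(c : ℝ)| * ‖a‖) = ∑ a ∈ x.support ∪ y.support, |(q a : ℝ)| * ‖a‖ := by
      intro q hq
      exact Finsupp.sum_of_support_subset _ hq _ (by simp)
    rw [e _ Finsupp.support_add, e _ Finset.subset_union_left, e _ Finset.subset_union_right,
      ← Finset.sum_add_distrib]
    refine Finset.sum_le_sum fun a _ => ?_
    rw [← add_mul]
    gcongr
    rw [Finsupp.add_apply]
    push_cast
    exact abs_add_le _ _
  neg' x := by
    rw [Finsupp.sum_neg_index (by simp)]
    simp

theorem wnorm_single {A : Type u} [SeminormedAddCommGroup A] (a : A) :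
    wnorm (Finsupp.single a (1 : ℚ)) = ‖a‖ := by
  change ((Finsupp.single a (1 : ℚ)).sum fun a c => |(c : ℝ)| * ‖a‖) = _
  rw [Finsupp.sum_single_index] <;> simp

theorem wnorm_smul {A : Type u} [SeminormedAddCommGroup A] (c : ℚ) (q : A →₀ ℚ) :
    wnorm (c • q) = |(c : ℝ)| * wnorm q := by
  change ((c • q).sum fun a c => |(c : ℝ)| * ‖a‖) = _ * (q.sum fun a c => |(c : ℝ)| * ‖a‖)
  rw [Finsupp.sum_smul_index (by simp), Finsupp.sum, Finsupp.sum, Finset.mul_sum]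
  refine Finset.sum_congr rfl fun a _ => ?_
  push_cast
  rw [abs_mul, mul_assoc]

/-- Inclusion of integral chains. -/
noncomputable def intInc (A : Type u) : (A →₀ ℤ) →+ (A →₀ ℚ) :=
  Finsupp.mapRange.addMonoidHom (Int.castAddHom ℚ)

theorem le_wnorm {A : Type u} [SeminormedAddCommGroup A] (z : A →₀ ℤ) :
    ‖Finsupp.linearCombination ℤ (id : A → A) z‖ ≤ wnorm (intInc A z) := by
  change _ ≤ ((Finsupp.mapRange (Int.castAddHom ℚ) (map_zero _) z).sum
    fun a c => |(c : ℝ)| * ‖a‖)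
  rw [Finsupp.sum_mapRange_index (by simp), Finsupp.linearCombination_apply]
  refine (norm_sum_le _ _).trans (Finset.sum_le_sum fun a _ => ?_)
  refine (norm_zsmul_le (n := z a) (a := a)).trans ?_
  simp [Int.norm_eq_abs]

theorem exists_divisible {A : Type u} [SeminormedAddCommGroup A] {κ : Cardinal.{u}}
    (hκ : Cardinal.aleph0 ≤ κ) (hA : Cardinal.mk A ≤ κ) :
    ∃ (E : Type u) (_ : NormedAddCommGroup E) (_ : CompleteSpace E) (ψ : A →+ E) (D : Set E),
      (∀ n : ℤ, n ≠ 0 → ∀ x : E, ∃ y, n • y = x) ∧ (∀ a, ‖ψ a‖ = ‖a‖) ∧ Dense D ∧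
      Cardinal.mk D ≤ κ := by
  let i1 : SeminormedAddCommGroup (A →₀ ℚ) := wnorm.toSeminormedAddCommGroup
  let i2 : NormedSpace ℚ (A →₀ ℚ) :=
    { norm_smul_le := fun c q => by
        change wnorm (c • q) ≤ ‖c‖ * wnorm q
        rw [wnorm_smul]; rfl }
  have hnorm : ∀ q : A →₀ ℚ, ‖q‖ = wnorm q := fun _ => rfl
  let W := Completion (A →₀ ℚ)
  let j : (A →₀ ℚ) →+ W := Completion.toCompl
  have hj : ∀ q, ‖j q‖ = ‖q‖ := fun q => Completion.norm_coe q
  have hjd : DenseRange j := Completion.denseRange_coe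
  let R0 : AddSubgroup W :=
    ((Finsupp.linearCombination ℤ (id : A → A)).toAddMonoidHom.ker).map (j.comp (intInc A))
  let R : AddSubgroup W := R0.topologicalClosure
  have hR : IsClosed (R : Set W) := R0.isClosed_topologicalClosure
  let π : W →+ W ⧸ R := QuotientAddGroup.mk' R
  have hπ : Function.Surjective π := QuotientAddGroup.mk'_surjective R
  have hπc : Continuous π := continuous_quot_mk
  let s : A → (A →₀ ℤ) := fun a => Finsupp.single a 1
  let φ : A → W ⧸ R := fun a => π (j (intInc A (s a)))
  have hs : ∀ a, wnorm (intInc A (s a)) = ‖a‖ := fun a => by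
    have : intInc A (s a) = Finsupp.single a 1 := by simp [intInc, s]
    rw [this, wnorm_single]
  let ψ : A →+ W ⧸ R := AddMonoidHom.mk' φ (by
    intro a b
    simp only [φ, ← map_add]
    refine (QuotientAddGroup.eq).2 ?_
    apply R0.le_topologicalClosure
    refine ⟨-s (a + b) + (s a + s b), ?_, ?_⟩
    · simp [AddMonoidHom.mem_ker, s]
    · simp only [AddMonoidHom.comp_apply, map_add, map_neg])
  refine ⟨W ⧸ R, inferInstance, inferInstance, ψ, Set.range (fun q => π (j q)), ?_, ?_, ?_, ?_⟩
  · intro n hn x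
    obtain ⟨w, rfl⟩ := hπ x
    refine ⟨π ((n : ℚ)⁻¹ • w), ?_⟩
    rw [← map_zsmul, ← Int.cast_smul_eq_zsmul ℚ n, smul_smul, mul_inv_cancel₀ (by exact_mod_cast hn),
      one_smul]
  · intro a
    apply le_antisymm
    · refine (QuotientAddGroup.norm_mk_le_norm).trans ?_
      rw [hj, hnorm, hs]
    · have key : ∀ r ∈ R, ‖a‖ ≤ ‖j (intInc A (s a)) + r‖ := by
        intro r hr
        have hcl : IsClosed {r : W | ‖a‖ ≤ ‖j (intInc A (s a)) + r‖} :=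
          isClosed_le continuous_const (by fun_prop)
        refine closure_minimal ?_ hcl hr
        rintro _ ⟨z, hz, rfl⟩
        change ‖a‖ ≤ ‖j (intInc A (s a)) + j (intInc A z)‖
        rw [← map_add, ← map_add, hj, hnorm]
        refine le_trans ?_ (le_wnorm _)
        have hz' : Finsupp.linearCombination ℤ (id : A → A) z = 0 := hz
        rw [map_add, hz']
        simp [s]
      refine le_of_forall_pos_le_add fun ε hε => ?_
      obtain ⟨w, hw, hlt⟩ := QuotientAddGroup.exists_norm_mk_lt (ψ a) hε
      have : -(j (intInc A (s a))) + w ∈ R := QuotientAddGroup.eq.1 hw.symm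
      have := key _ this
      rw [add_neg_cancel_left] at this
      linarith
  · exact hπ.denseRange.comp hjd hπc
  · exact Cardinal.mk_range_le.trans (card_finsupp_le hκ hA)

theorem exists_divisible' {A : Type u} [SeminormedAddCommGroup A] {κ : Cardinal.{u}}
    (hκ : Cardinal.aleph0 ≤ κ) (D : Set A) (hD : Dense D) (hDκ : Cardinal.mk D ≤ κ) :
    ∃ (E : Type u) (_ : NormedAddCommGroup E) (ψ : A →+ E) (D : Set E),
      (∀ n : ℤ, n ≠ 0 → ∀ x : E, ∃ y, n • y = x) ∧ (∀ a, ‖ψ a‖ = ‖a‖) ∧ Dense D ∧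
      Cardinal.mk D ≤ κ := by
  let H0 : AddSubgroup A :=
    (Finsupp.linearCombination ℤ (Subtype.val : D → A)).toAddMonoidHom.range
  have hH0 : Cardinal.mk H0 ≤ κ :=
    (Cardinal.mk_range_le (f := Finsupp.linearCombination ℤ (Subtype.val : D → A))).trans
      (card_finsupp_le hκ hDκ)
  have hsub : D ⊆ H0 := fun d hd => ⟨Finsupp.single ⟨d, hd⟩ 1, by simp⟩
  obtain ⟨E, _, _, ψ, D', h1, h2, h3, h4⟩ := exists_divisible hκ hH0
  have hdense : DenseRange (Subtype.val : H0 → A) := by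
    rw [DenseRange, Subtype.range_coe]; exact hD.mono hsub
  have hui : IsUniformInducing (Subtype.val : H0 → A) := isUniformInducing_val _
  have hiso : Isometry ψ := AddMonoidHomClass.isometry_of_norm ψ h2
  have huc := hiso.uniformContinuous
  have cont := (uniformContinuous_uniformly_extend hui hdense huc).continuous
  have eq := uniformly_extend_of_ind hui hdense huc
  let Ψ : A →+ E := AddMonoidHom.mk' ((hui.isDenseInducing hdense).extend ψ) (by
    refine hdense.induction_on₂ ?_ ?_
    · exact isClosed_eq (cont.comp continuous_add)
          ((cont.comp continuous_fst).add (cont.comp continuous_snd))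
    · intro x y
      have := eq (x + y)
      rw [eq, eq, ← map_add, ← this]; rfl)
  refine ⟨E, inferInstance, Ψ, D', h1, ?_, h3, h4⟩
  intro a
  refine hdense.induction_on a (isClosed_eq cont.norm continuous_norm) ?_
  intro x
  change ‖(hui.isDenseInducing hdense).extend ψ x‖ = _
  rw [eq, h2]; rfl

theorem extend_divisible {G E : Type u} [AddCommGroup G] [AddCommGroup E] (H : AddSubgroup G)
    (hE : ∀ n : ℤ, n ≠ 0 → ∀ x : E, ∃ y, n • y = x) (ψ : H →+ E) :
    ∃ φ : G →+ E, ∀ x : H, φ x = ψ x := by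
  let : DivisibleBy E ℤ := by
    classical
    exact
      { div := fun x n => if hn : n = 0 then 0 else (hE n hn x).choose
        div_zero := fun x => by simp
        div_cancel := fun {n} x hn => by
          simp only [hn, dite_false]
          exact (hE n hn x).choose_spec }
  have hmono : CategoryTheory.Mono (AddCommGrpCat.ofHom H.subtype) := by
    rw [AddCommGrpCat.mono_iff_injective]; exact Subtype.val_injective
  let g := CategoryTheory.Injective.factorThru (AddCommGrpCat.ofHom ψ)
    (AddCommGrpCat.ofHom H.subtype)
  refine ⟨g.hom, fun x => ?_⟩
  have := CategoryTheory.Injective.comp_factorThru (AddCommGrpCat.ofHom ψ)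
    (AddCommGrpCat.ofHom H.subtype)
  exact congrArg (fun f => f.hom x) this

/-- Theorem (main): Any pseudonorm on a subgroup `H` of an abelian group `G` extends to a
pseudonorm on `G` with the same density of the associated pseudometric space. -/
theorem pseudonorm_extension_preserving_density {G : Type u} [AddCommGroup G]
    (H : AddSubgroup G) (fH : H → ℝ)
    (h0 : fH 0 = 0) (hnn : ∀ x, 0 ≤ fH x)
    (htri : ∀ x y, fH (x - y) ≤ fH x + fH y) :
    ∃ fG : G → ℝ, fG 0 = 0 ∧ (∀ x, 0 ≤ fG x) ∧
      (∀ x y, fG (x - y) ≤ fG x + fG y) ∧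
      (∀ x : H, fG (x : G) = fH x) ∧
      ∀ κ : Cardinal.{u}, Cardinal.aleph0 ≤ κ →
        ((∃ D : Set H, Cardinal.mk D ≤ κ ∧
            ∀ x : H, ∀ ε : ℝ, 0 < ε → ∃ y ∈ D, fH (x - y) < ε) ↔
         (∃ D : Set G, Cardinal.mk D ≤ κ ∧
            ∀ x : G, ∀ ε : ℝ, 0 < ε → ∃ y ∈ D, fG (x - y) < ε)) := by
  have hneg' : ∀ x, fH (-x) ≤ fH x := fun x => by
    have := htri 0 x
    rwa [h0, zero_add, zero_sub] at this
  have hneg : ∀ x, fH (-x) = fH x := fun x =>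
    le_antisymm (hneg' x) (by simpa using hneg' (-x))
  let N : AddGroupSeminorm H :=
    { toFun := fH
      map_zero' := h0
      add_le' := fun x y => by
        have := htri x (-y)
        rwa [sub_neg_eq_add, hneg] at this
      neg' := hneg }
  let P : Cardinal.{u} → Prop := fun κ => Cardinal.aleph0 ≤ κ ∧
    ∃ D : Set H, Cardinal.mk D ≤ κ ∧ ∀ x : H, ∀ ε : ℝ, 0 < ε → ∃ y ∈ D, fH (x - y) < ε
  have hP : ∃ κ, P κ := ⟨max Cardinal.aleph0 (Cardinal.mk H), le_max_left _ _, Set.univ,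
    (Cardinal.mk_set_le _).trans (le_max_right _ _), fun x ε hε => ⟨x, trivial, by simpa [h0]⟩⟩
  obtain ⟨κ₀, ⟨hκ₀, D₀, hD₀, hd₀⟩, hmin⟩ :=
    WellFounded.has_min (wellFounded_lt : WellFounded ((· < ·) : Cardinal.{u} → _ → Prop)) {κ | P κ} hP
  let : SeminormedAddCommGroup H := N.toSeminormedAddCommGroup
  have hN : ∀ x : H, ‖x‖ = fH x := fun _ => rfl
  have hdense : Dense D₀ := by
    rw [Metric.dense_iff]
    intro x r hr
    obtain ⟨y, hy, hxy⟩ := hd₀ x r hr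
    refine ⟨y, ?_, hy⟩
    rw [Metric.mem_ball, dist_comm, dist_eq_norm, hN]
    exact hxy
  obtain ⟨E, _, ψ, DE, hdiv, hψ, hDE, hDEκ⟩ := exists_divisible' hκ₀ D₀ hdense hD₀
  obtain ⟨φ, hφ⟩ := extend_divisible H hdiv ψ
  have hext : ∀ x : H, ‖φ x‖ = fH x := fun x => by rw [hφ, hψ, hN]
  refine ⟨fun x => ‖φ x‖, by simp, fun x => norm_nonneg _, fun x y => ?_, hext, ?_⟩
  · simp only [map_sub]; exact norm_sub_le _ _
  intro κ hκ
  constructor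
  · intro hD
    have hle : κ₀ ≤ κ := not_lt.1 (hmin κ ⟨hκ, hD⟩)
    obtain ⟨D', h1, h2⟩ := density_sub φ dist dist_comm dist_triangle hκ DE (hDEκ.trans hle)
      (fun x ε hε => by
        obtain ⟨y, hy, hxy⟩ := Metric.dense_iff.1 hDE x ε hε
        exact ⟨y, hxy, by rw [dist_comm]; exact hy⟩)
    refine ⟨D', h1, fun x ε hε => ?_⟩
    obtain ⟨y, hy, hxy⟩ := h2 x ε hε
    exact ⟨y, hy, by simpa only [map_sub, ← dist_eq_norm] using hxy⟩
  · rintro ⟨D, hD, hd⟩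
    obtain ⟨D', h1, h2⟩ := density_sub (Subtype.val : H → G) (fun x y => dist (φ x) (φ y))
      (fun x y => dist_comm _ _) (fun x y z => dist_triangle _ _ _) hκ D hD
      (fun x ε hε => by
        obtain ⟨y, hy, hxy⟩ := hd x ε hε
        exact ⟨y, hy, by rwa [dist_eq_norm, ← map_sub]⟩)
    refine ⟨D', h1, fun x ε hε => ?_⟩
    obtain ⟨y, hy, hxy⟩ := h2 x ε hε
    refine ⟨y, hy, ?_⟩
    rwa [dist_eq_norm, ← map_sub, ← AddSubgroup.coe_sub, hext] at hxy
end

section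
/- Let G be an abelian group, H a subgroup of G, and |·|_H a pseudonorm on H such that the pseudometric space (H, d_H) with d_H(x,y) = |x−y|_H is separable (has a countable dense subset). Then there exists a pseudonorm |·|_G on G extending |·|_H such that the pseudometric space (G, d_G) with d_G(x,y) = |x−y|_G is separable. -/
open TopologicalSpace Filter Topology in
theorem pse_countable.{u} {D : Type u} [SeminormedAddCommGroup D] [Countable D] :
    ∃ (K : Type u) (_ : NormedAddCommGroup K) (_ : CompleteSpace K) (_ : SeparableSpace K)
      (ψ : D →+ K), (∀ n : ℤ, n ≠ 0 → ∀ x : K, ∃ y, n • y = x) ∧ ∀ d, ‖ψ d‖ = ‖d‖ := by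
  classical
  let E := lp (fun _ : D => ℝ) 1
  have hsepE : SeparableSpace E := by
    let S : Set E := Set.range fun d : D => lp.single 1 d (1 : ℝ)
    have hS : IsSeparable (closure (Submodule.span ℝ S : Set E)) :=
      ((Set.countable_range _).isSeparable.span (R := ℝ)).closure
    rw [← isSeparable_univ_iff]
    refine hS.mono fun f _ => ?_
    have hf := lp.hasSum_single (E := fun _ : D => ℝ) (p := 1) ENNReal.one_ne_top f
    refine mem_closure_of_tendsto hf (Eventually.of_forall fun s => ?_)
    refine Submodule.sum_mem _ fun d _ => ?_
    have : lp.single 1 d (f d) = (f d) • (lp.single 1 d (1 : ℝ) : E) := by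
      rw [← lp.single_smul]; simp
    rw [this]
    exact Submodule.smul_mem _ _ (Submodule.subset_span ⟨d, rfl⟩)
  let T : (D →₀ ℤ) →+ E := Finsupp.liftAddHom fun d =>
    (lp.singleAddMonoidHom (E := fun _ : D => ℝ) 1 d).comp
      ((AddMonoidHom.mulRight ‖d‖).comp (Int.castAddHom ℝ))
  let ev : (D →₀ ℤ) →+ D := (Finsupp.linearCombination ℤ (id : D → D)).toAddMonoidHom
  have hT1 : ∀ d n, T (Finsupp.single d n) = lp.single 1 d ((n : ℝ) * ‖d‖) := by
    intro d n; simp [T]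
  have hev1 : ∀ d, ev (Finsupp.single d 1) = d := by
    intro d; simp [ev]
  have hTa : ∀ q d, (T q : E) d = (q d : ℝ) * ‖d‖ := by
    intro q d
    induction q using Finsupp.induction_linear with
    | zero => simp
    | add f g hf hg => simp [map_add, hf, hg, add_mul]
    | single a n =>
      rw [hT1, lp.single_apply]
      by_cases h : a = d
      · subst h; simp
      · simp [h]
  have hTn : ∀ q, ‖ev q‖ ≤ ‖T q‖ := by
    intro q
    have h1 := lp.sum_rpow_le_norm_rpow (E := fun _ : D => ℝ) (p := 1) (by simp) (T q) q.support
    simp only [ENNReal.toReal_one, Real.rpow_one, hTa] at h1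
    refine le_trans ?_ h1
    have : ev q = ∑ d ∈ q.support, q d • d := by
      simp [ev, Finsupp.linearCombination_apply, Finsupp.sum]
    rw [this]
    refine (norm_sum_le _ _).trans (Finset.sum_le_sum fun d _ => ?_)
    refine (norm_zsmul_le _ _).trans ?_
    simp [Int.norm_eq_abs]
  let N : AddSubgroup E := (ev.ker.map T).topologicalClosure
  have hNc : IsClosed (N : Set E) := AddSubgroup.isClosed_topologicalClosure _
  let m : E →+ E ⧸ N := QuotientAddGroup.mk' N
  have hker : ∀ q, ev q = 0 → m (T q) = 0 := by
    intro q hq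
    rw [← AddMonoidHom.mem_ker, QuotientAddGroup.ker_mk']
    exact AddSubgroup.le_topologicalClosure _ ⟨q, hq, rfl⟩
  let ψ : D →+ E ⧸ N := AddMonoidHom.mk' (fun d => m (T (Finsupp.single d 1))) (by
    intro a b
    rw [← map_add, ← map_add, ← sub_eq_zero, ← map_sub, ← map_sub]
    apply hker
    simp [hev1])
  refine ⟨E ⧸ N, inferInstance, inferInstance, inferInstance, ψ, ?_, ?_⟩
  · intro n hn x
    obtain ⟨x, rfl⟩ := QuotientAddGroup.mk'_surjective N x
    refine ⟨m (((n : ℝ)⁻¹) • x), ?_⟩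
    rw [← map_zsmul]
    congr 1
    rw [← Int.cast_smul_eq_zsmul ℝ, smul_smul, mul_inv_cancel₀ (by exact_mod_cast hn), one_smul]
  · intro d
    change ‖((T (Finsupp.single d 1) : E) : E ⧸ N)‖ = ‖d‖
    apply le_antisymm
    · refine QuotientAddGroup.norm_mk_le_norm.trans ?_
      rw [hT1, lp.norm_single (by simp)]
      simp
    · rw [QuotientAddGroup.norm_mk]
      change _ ≤ Metric.infDist _ (closure (ev.ker.map T : Set E))
      rw [Metric.infDist_closure, Metric.le_infDist ⟨0, zero_mem (ev.ker.map T)⟩]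
      rintro _ ⟨q, hq, rfl⟩
      rw [dist_eq_norm, ← map_sub]
      refine le_trans (le_of_eq ?_) (hTn _)
      have : ev q = 0 := hq
      rw [map_sub, this, hev1, sub_zero]

open TopologicalSpace Filter Topology in
theorem pse_separable.{u} {H : Type u} [SeminormedAddCommGroup H] [SeparableSpace H] :
    ∃ (K : Type u) (_ : NormedAddCommGroup K) (_ : SeparableSpace K)
      (φ : H →+ K), (∀ n : ℤ, n ≠ 0 → ∀ x : K, ∃ y, n • y = x) ∧ ∀ h, ‖φ h‖ = ‖h‖ := by
  obtain ⟨s, hs, hd⟩ := exists_countable_dense H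
  let D : AddSubgroup H := AddSubgroup.closure s
  have hDc : Countable D := by
    have := hs.to_subtype
    have hc : D = (Submodule.span ℤ s).toAddSubgroup := by
      rw [Submodule.span_int_eq_addSubgroupClosure]
    have hr := Finsupp.range_linearCombination ℤ (v := ((↑) : s → H))
    rw [Subtype.range_coe] at hr
    have : (D : Set H) = Set.range (Finsupp.linearCombination ℤ ((↑) : s → H)) := by
      rw [hc, ← hr]; rfl
    have h2 : (D : Set H).Countable := by
      rw [this]; exact Set.countable_range _
    exact h2.to_subtype
  have hDd : DenseRange ((↑) : D → H) := by
    rw [DenseRange, Subtype.range_coe]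
    exact hd.mono AddSubgroup.subset_closure
  obtain ⟨K, i1, i2, i3, ψ, hdiv, hψ⟩ := pse_countable (D := D)
  have hu : IsUniformInducing ((↑) : D → H) := isUniformInducing_val _
  have huψ : UniformContinuous ψ :=
    (AddMonoidHomClass.isometry_of_norm ψ hψ).uniformContinuous
  have hdi : IsDenseInducing ((↑) : D → H) := hu.isDenseInducing hDd
  let F : H → K := hdi.extend ψ
  have hF : Continuous F := (uniformContinuous_uniformly_extend hu hDd huψ).continuous
  have hFe : ∀ d : D, F d = ψ d := fun d => uniformly_extend_of_ind hu hDd huψ d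
  refine ⟨K, i1, i3, AddMonoidHom.mk' F ?_, hdiv, ?_⟩
  · intro a b
    refine hDd.induction_on₂ (p := fun a b => F (a + b) = F a + F b) ?_ ?_ a b
    · exact isClosed_eq (by fun_prop) (by fun_prop)
    · intro a b
      rw [← AddSubgroup.coe_add, hFe, hFe, hFe, map_add]
  · intro h
    change ‖F h‖ = ‖h‖
    refine hDd.induction_on (p := fun h => ‖F h‖ = ‖h‖) h ?_ ?_
    · exact isClosed_eq (by fun_prop) (by fun_prop)
    · intro d
      rw [hFe, hψ]; rfl


/-- Any pseudonorm on a subgroup `H` of an abelian group `G` whose associated pseudometric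
space is separable extends to a pseudonorm on `G` whose associated pseudometric space is
separable. -/
theorem pseudonorm_extension_separable {G : Type*} [AddCommGroup G]
    (H : AddSubgroup G) (fH : H → ℝ)
    (h0 : fH 0 = 0) (hnn : ∀ x, 0 ≤ fH x)
    (htri : ∀ x y, fH (x - y) ≤ fH x + fH y)
    (hsep : ∃ D : Set H, D.Countable ∧
      ∀ x : H, ∀ ε : ℝ, 0 < ε → ∃ y ∈ D, fH (x - y) < ε) :
    ∃ fG : G → ℝ, fG 0 = 0 ∧ (∀ x, 0 ≤ fG x) ∧
      (∀ x y, fG (x - y) ≤ fG x + fG y) ∧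
      (∀ x : H, fG (x : G) = fH x) ∧
      ∃ D : Set G, D.Countable ∧
        ∀ x : G, ∀ ε : ℝ, 0 < ε → ∃ y ∈ D, fG (x - y) < ε := by

  have hneg : ∀ x, fH (-x) ≤ fH x := fun x => by
    have := htri 0 x
    rwa [zero_sub, h0, zero_add] at this
  let S : AddGroupSeminorm H :=
    { toFun := fH
      map_zero' := h0
      add_le' := fun x y => by
        have h1 := htri x (-y)
        rw [sub_neg_eq_add] at h1
        linarith [hneg y]
      neg' := fun x => le_antisymm (hneg x) (by simpa using hneg (-x)) }
  let _ : SeminormedAddCommGroup H := S.toSeminormedAddCommGroup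
  have hnorm : ∀ x : H, ‖x‖ = fH x := fun x => rfl
  obtain ⟨D, hDc, hD⟩ := hsep
  have : TopologicalSpace.SeparableSpace H := ⟨D, hDc, fun x => by
    rw [Metric.mem_closure_iff]
    intro ε hε
    obtain ⟨y, hy, hxy⟩ := hD x ε hε
    exact ⟨y, hy, by rw [dist_eq_norm]; exact hxy⟩⟩
  obtain ⟨K, i1, i3, φ, hdiv, hφ⟩ := pse_separable (H := H)
  choose! dv hdv using hdiv
  let _ : DivisibleBy K ℤ :=
    { div := fun x n => if n = 0 then 0 else dv n x
      div_zero := fun x => by simp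
      div_cancel := fun {n} x hn => by simp [hn, hdv n hn x] }
  obtain ⟨Φ, hΦ⟩ := (Module.Baer.of_divisible K).extension_property_addMonoidHom
    H.subtype H.subtype_injective φ
  have hΦ' : ∀ x : H, Φ x = φ x := fun x => DFunLike.congr_fun hΦ x
  refine ⟨fun g => ‖Φ g‖, by simp, fun _ => norm_nonneg _, fun x y => ?_, fun x => ?_, ?_⟩
  · simp only [map_sub]; exact norm_sub_le _ _
  · change ‖Φ x‖ = _
    rw [hΦ', hφ, hnorm]
  · obtain ⟨t, hts, htc, ht⟩ := (TopologicalSpace.IsSeparable.of_separableSpace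
      (Set.range Φ)).exists_countable_dense_subset
    have hts' : ∀ y : K, ∃ g : G, y ∈ t → Φ g = y := fun y => by
      by_cases hy : y ∈ t
      · obtain ⟨g, hg⟩ := hts hy
        exact ⟨g, fun _ => hg⟩
      · exact ⟨0, fun h => absurd h hy⟩
    choose r hr using hts'
    refine ⟨r '' t, htc.image r, fun x ε hε => ?_⟩
    obtain ⟨y, hy, hxy⟩ := Metric.mem_closure_iff.1 (ht ⟨x, rfl⟩) ε hε
    refine ⟨r y, ⟨y, hy, rfl⟩, ?_⟩
    simp only [map_sub]
    rw [hr y hy, ← dist_eq_norm]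
    exact hxy
end

section
/- Let p be a prime number, G an abelian group, and H a subgroup of G such that p·g ∈ H for every g ∈ G (i.e. pG ⊆ H). Then any pseudonorm |·|_H on H can be extended to a pseudonorm |·|_G on G such that for every infinite cardinal κ, the pseudometric space (H, d_H) with d_H(x,y) = |x−y|_H has a dense subset of cardinality ≤ κ if and only if the pseudometric space (G, d_G) with d_G(x,y) = |x−y|_G has a dense subset of cardinality ≤ κ. -/
set_option linter.unusedSectionVars false

namespace PNExt

theorem card_closure_le {G : Type u} [AddCommGroup G] (s : Set G) (κ : Cardinal.{u})
    (hκ : Cardinal.aleph0 ≤ κ) (hs : Cardinal.mk s ≤ κ) :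
    Cardinal.mk (AddSubgroup.closure s) ≤ κ := by
  have h1 : (AddSubgroup.closure s : Set G) =
      Set.range (FreeAddGroup.lift ((↑) : s → G)) := by
    rw [FreeAddGroup.closure_eq_range]; rfl
  have h2 : Cardinal.mk (FreeAddGroup s) ≤ κ := by
    refine Cardinal.mk_quot_le.trans ((Cardinal.mk_list_le_max _).trans (max_le hκ ?_))
    rw [Cardinal.mk_prod]
    simp only [Cardinal.lift_uzero]
    refine Cardinal.mul_le_of_le hκ hs ?_
    exact (Cardinal.lift_le_aleph0.2 Cardinal.mk_le_aleph0).trans hκ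
  calc Cardinal.mk (AddSubgroup.closure s)
      = Cardinal.mk (AddSubgroup.closure s : Set G) := rfl
    _ ≤ _ := by rw [h1]; exact Cardinal.mk_range_le
    _ ≤ κ := h2

/-- The pseudonorm axioms. -/
structure PN {H : Type*} [AddCommGroup H] (f : H → ℝ) : Prop where
  zero : f 0 = 0
  nonneg : ∀ x, 0 ≤ f x
  tri : ∀ x y, f (x - y) ≤ f x + f y

section
variable {H : Type*} [AddCommGroup H] {f : H → ℝ}

theorem PN.neg_le (hf : PN f) (x : H) : f (-x) ≤ f x := by
  have := hf.tri 0 x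
  simpa [hf.zero] using this

theorem PN.neg (hf : PN f) (x : H) : f (-x) = f x :=
  le_antisymm (hf.neg_le x) (by simpa using hf.neg_le (-x))

theorem PN.add (hf : PN f) (x y : H) : f (x + y) ≤ f x + f y := by
  have := hf.tri x (-y)
  rwa [sub_neg_eq_add, hf.neg] at this

theorem PN.sub_comm (hf : PN f) (x y : H) : f (x - y) = f (y - x) := by
  rw [← hf.neg, neg_sub]

theorem PN.nsmul (hf : PN f) (n : ℕ) (x : H) : f (n • x) ≤ n * f x := by
  induction n with
  | zero => simp [hf.zero]
  | succ n ih =>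
    rw [succ_nsmul]; push_cast
    linarith [hf.add (n • x) x]

theorem PN.zsmul (hf : PN f) (z : ℤ) (x : H) : f (z • x) ≤ |(z : ℝ)| * f x := by
  obtain ⟨n, rfl | rfl⟩ := z.eq_nat_or_neg
  · simpa using hf.nsmul n x
  · simpa [hf.neg] using hf.nsmul n x

theorem PN.sum (hf : PN f) {α : Type*} (s : Finset α) (g : α → H) :
    f (∑ i ∈ s, g i) ≤ ∑ i ∈ s, f (g i) :=
  Finset.le_sum_of_subadditive f hf.zero.le hf.add s g

/-- Weighted l1 norm on the free abelian group. -/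
noncomputable def W (f : H → ℝ) (v : H →₀ ℤ) : ℝ := v.sum fun d z => |(z : ℝ)| * f d

theorem W_nonneg (hf : PN f) (v : H →₀ ℤ) : 0 ≤ W f v :=
  Finset.sum_nonneg fun _ _ => mul_nonneg (abs_nonneg _) (hf.nonneg _)

theorem W_zero : W f 0 = 0 := by simp [W]

theorem W_single (d : H) (z : ℤ) : W f (Finsupp.single d z) = |(z : ℝ)| * f d := by
  simp [W]

theorem W_sub (hf : PN f) (v w : H →₀ ℤ) : W f (v - w) ≤ W f v + W f w := by
  classical
  have key : ∀ u : H →₀ ℤ, u.support ⊆ v.support ∪ w.support →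
      W f u = ∑ d ∈ v.support ∪ w.support, |(u d : ℝ)| * f d := by
    intro u hu
    exact Finsupp.sum_of_support_subset _ hu _ (by simp)
  rw [key _ Finsupp.support_sub, key v Finset.subset_union_left, key w Finset.subset_union_right,
    ← Finset.sum_add_distrib]
  refine Finset.sum_le_sum fun d _ => ?_
  rw [← add_mul]
  refine mul_le_mul_of_nonneg_right ?_ (hf.nonneg d)
  rw [Finsupp.sub_apply]; push_cast
  exact abs_sub _ _

theorem W_nsmul (p : ℕ) (v : H →₀ ℤ) : W f (p • v) = p * W f v := by
  rw [W, Finsupp.sum_of_support_subset (s := v.support) _ Finsupp.support_smul _ (by simp),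
    W, Finsupp.sum, Finset.mul_sum]
  refine Finset.sum_congr rfl fun d _ => ?_
  simp [abs_mul, mul_assoc]

theorem le_W (hf : PN f) (v : H →₀ ℤ) : f (v.sum fun d z => z • d) ≤ W f v :=
  (hf.sum _ _).trans (Finset.sum_le_sum fun _ _ => hf.zsmul _ _)

variable {ι : Type*} (c : ι → ℕ → H)

/-- Level part of the norm. -/
noncomputable def L (f : H → ℝ) (n : ℕ) (l : ι →₀ ℤ) : ℝ :=
  W f (Finsupp.mapDomain.addMonoidHom (fun i => c i n) l)

/-- The norm on the free group. -/
noncomputable def N (f : H → ℝ) (l : ι →₀ ℤ) : ℝ := ∑' n, L c f n l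

variable {c}

theorem L_sub (hf : PN f) (n : ℕ) (l m : ι →₀ ℤ) :
    L c f n (l - m) ≤ L c f n l + L c f n m := by
  unfold L; rw [map_sub]; exact W_sub hf _ _

theorem L_nonneg (hf : PN f) (n : ℕ) (l : ι →₀ ℤ) : 0 ≤ L c f n l := W_nonneg hf _

theorem L_zero (n : ℕ) : L c f n 0 = 0 := by unfold L; rw [map_zero, W_zero]

theorem L_single (n : ℕ) (i : ι) (z : ℤ) :
    L c f n (Finsupp.single i z) = |(z : ℝ)| * f (c i n) := by
  simp [L, Finsupp.mapDomain.addMonoidHom, W_single]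

theorem L_nsmul (n p : ℕ) (l : ι →₀ ℤ) : L c f n (p • l) = p * L c f n l := by
  unfold L; rw [map_nsmul, W_nsmul]

theorem L_summable (hf : PN f) (hc : ∀ i, Summable fun n => f (c i n)) (l : ι →₀ ℤ) :
    Summable fun n => L c f n l := by
  induction l using Finsupp.induction_linear with
  | zero => simp [L_zero]
  | add l m hl hm =>
    refine Summable.of_nonneg_of_le (fun n => L_nonneg hf n _) (fun n => ?_) (hl.add hm)
    have h1 := L_sub (c := c) hf n l (0 - m)
    have h2 := L_sub (c := c) hf n 0 m
    rw [L_zero] at h2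
    have : l - (0 - m) = l + m := by abel
    rw [this] at h1
    linarith
  | single i z =>
    simp only [L_single]
    exact (hc i).mul_left _

theorem N_nonneg (hf : PN f) (l : ι →₀ ℤ) : 0 ≤ N c f l := tsum_nonneg fun n => L_nonneg hf n l

theorem N_zero : N c f 0 = 0 := by simp [N, L_zero]

theorem N_sub (hf : PN f) (hc : ∀ i, Summable fun n => f (c i n)) (l m : ι →₀ ℤ) :
    N c f (l - m) ≤ N c f l + N c f m := by
  unfold N
  rw [← (L_summable hf hc l).tsum_add (L_summable hf hc m)]
  exact (L_summable hf hc _).tsum_le_tsum (fun n => L_sub hf n l m)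
    ((L_summable hf hc l).add (L_summable hf hc m))

theorem N_nsmul (p : ℕ) (l : ι →₀ ℤ) : N c f (p • l) = p * N c f l := by
  simp only [N, L_nsmul]; exact tsum_mul_left

theorem le_N (hf : PN f) (hc : ∀ i, Summable fun n => f (c i n)) (x : ι → H)
    (hx : ∀ i, Filter.Tendsto (fun k => f (x i - ∑ n ∈ Finset.range k, c i n)) Filter.atTop (nhds 0))
    (l : ι →₀ ℤ) : f (l.sum fun i z => z • x i) ≤ N c f l := by
  have hlim : Filter.Tendsto (fun k => N c f l +
      ∑ i ∈ l.support, |(l i : ℝ)| * f (x i - ∑ n ∈ Finset.range k, c i n))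
      Filter.atTop (nhds (N c f l + ∑ i ∈ l.support, |(l i : ℝ)| * 0)) :=
    tendsto_const_nhds.add (tendsto_finsetSum _ fun i _ => (hx i).const_mul _)
  simp only [mul_zero, Finset.sum_const_zero, add_zero] at hlim
  refine ge_of_tendsto' hlim fun k => ?_
  have e : (l.sum fun i z => z • x i) =
      (∑ n ∈ Finset.range k,
        (Finsupp.mapDomain (fun i => c i n) l).sum fun d z => z • d) +
      ∑ i ∈ l.support, l i • (x i - ∑ n ∈ Finset.range k, c i n) := by
    have : ∀ n, ((Finsupp.mapDomain (fun i => c i n) l).sum fun d z => z • d)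
        = ∑ i ∈ l.support, l i • c i n := by
      intro n
      rw [Finsupp.sum_mapDomain_index (by simp) (by intros; rw [add_smul])]
      rfl
    simp only [this]
    rw [Finset.sum_comm, ← Finset.sum_add_distrib]
    refine Finset.sum_congr rfl fun i _ => ?_
    rw [smul_sub, Finset.smul_sum]; abel
  rw [e]
  refine (hf.add _ _).trans (add_le_add ?_ ?_)
  · refine (hf.sum _ _).trans ?_
    refine le_trans (Finset.sum_le_sum fun n _ => le_W hf _) ?_
    exact (L_summable hf hc l).sum_le_tsum _ (fun n _ => L_nonneg hf n l)
  · exact (hf.sum _ _).trans (Finset.sum_le_sum fun i _ => hf.zsmul _ _)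

theorem N_pair (hf : PN f) (hc : ∀ i, Summable fun n => f (c i n))
    (hb : ∀ i n, 1 ≤ n → f (c i n) ≤ 4 * (1 / 2) ^ n) (k : ℕ) (hk : 1 ≤ k) (i j : ι)
    (hij : ∀ n < k, c i n = c j n) :
    N c f (Finsupp.single i 1 - Finsupp.single j 1) ≤ 16 * (1 / 2) ^ k := by
  unfold N
  rw [← (L_summable hf hc _).sum_add_tsum_nat_add k]
  have h1 : ∑ n ∈ Finset.range k, L c f n (Finsupp.single i 1 - Finsupp.single j 1) = 0 := by
    refine Finset.sum_eq_zero fun n hn => ?_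
    have e : Finsupp.mapDomain.addMonoidHom (fun i => c i n) (Finsupp.single i (1 : ℤ)) =
        Finsupp.mapDomain.addMonoidHom (fun i => c i n) (Finsupp.single j (1 : ℤ)) := by
      simp [Finsupp.mapDomain.addMonoidHom, hij n (Finset.mem_range.1 hn)]
    unfold L
    rw [map_sub, e, sub_self, W_zero]
  rw [h1, zero_add]
  have hs : HasSum (fun n : ℕ => (8 * (1 / 2 : ℝ) ^ k) * (1 / 2) ^ n) (8 * (1 / 2 : ℝ) ^ k * 2) :=
    hasSum_geometric_two.mul_left _
  have h2 := ((summable_nat_add_iff k).2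
    (L_summable hf hc (Finsupp.single i 1 - Finsupp.single j 1))).tsum_le_tsum (fun n => ?_)
    hs.summable
  · rw [hs.tsum_eq] at h2
    linarith
  · refine (L_sub hf _ _ _).trans ?_
    rw [L_single, L_single]
    have a := hb i (n + k) (by omega)
    have b := hb j (n + k) (by omega)
    rw [pow_add] at a b
    simp only [Int.cast_one, abs_one, one_mul]
    nlinarith
end


theorem exists_basis_aux {G V : Type u} [AddCommGroup G] [AddCommGroup V] (p : ℕ)
    [Fact p.Prime] [Module (ZMod p) V]
    (H : AddSubgroup G) (q : G →+ V) (hs : Function.Surjective q) (hq : q.ker = H) :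
    ∃ (ι : Type u) (b : ι → G),
      (∀ g, ∃ h : H, ∃ l : ι →₀ ℤ, g = h + l.sum fun i z => z • b i) ∧
      ∀ l : ι →₀ ℤ, (l.sum fun i z => z • b i) ∈ H → ∃ m : ι →₀ ℤ, l = p • m := by
  classical
  obtain ⟨ι, ⟨B⟩⟩ : ∃ ι : Type u, Nonempty (Module.Basis ι (ZMod p) V) :=
    ⟨_, ⟨Module.Basis.ofVectorSpace (ZMod p) V⟩⟩
  have hB : ∀ i : ι, ∃ g : G, q g = B i := fun i => hs _
  choose b hb using hB
  have hsum : ∀ l : ι →₀ ℤ, q (l.sum fun i z => z • b i) =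
      Finsupp.linearCombination (ZMod p) B (l.mapRange (Int.cast : ℤ → ZMod p) (by simp)) := by
    intro l
    rw [Finsupp.linearCombination_apply, Finsupp.sum_mapRange_index (by simp), Finsupp.sum,
      map_sum]
    refine Finset.sum_congr rfl fun i _ => ?_
    rw [map_zsmul, hb]; exact (Int.cast_smul_eq_zsmul (ZMod p) _ _).symm
  refine ⟨_, b, fun g => ?_, fun l hl => ?_⟩
  · let r := B.repr (q g)
    let l := r.mapRange (fun z : ZMod p => (z.val : ℤ)) (by simp)
    have h1 : q (l.sum fun i z => z • b i) = q g := by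
      rw [hsum, ← B.linearCombination_repr (q g)]
      congr 1
      ext i
      simp [l, r]
    have h2 : g - (l.sum fun i z => z • b i) ∈ H := by
      rw [← hq, AddMonoidHom.mem_ker, map_sub, h1, sub_self]
    exact ⟨⟨_, h2⟩, l, by simp⟩
  · rw [← hq, AddMonoidHom.mem_ker, hsum] at hl
    have h0 := linearIndependent_iff.1 B.linearIndependent _ hl
    have hd : ∀ i, (p : ℤ) ∣ l i := by
      intro i
      have := DFunLike.congr_fun h0 i
      simp only [Finsupp.mapRange_apply, Finsupp.coe_zero, Pi.zero_apply] at this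
      exact (ZMod.intCast_zmod_eq_zero_iff_dvd _ _).1 this
    refine ⟨l.mapRange (fun z => z / p) (by simp), ?_⟩
    ext i
    simp only [Finsupp.smul_apply, Finsupp.mapRange_apply, nsmul_eq_mul]
    exact (Int.mul_ediv_cancel' (hd i)).symm

theorem exists_basis {G : Type u} [AddCommGroup G] (p : ℕ) (hp : p.Prime)
    (H : AddSubgroup G) (hpG : ∀ g : G, p • g ∈ H) :
    ∃ (ι : Type u) (b : ι → G),
      (∀ g, ∃ h : H, ∃ l : ι →₀ ℤ, g = h + l.sum fun i z => z • b i) ∧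
      ∀ l : ι →₀ ℤ, (l.sum fun i z => z • b i) ∈ H → ∃ m : ι →₀ ℤ, l = p • m := by
  have : Fact p.Prime := ⟨hp⟩
  let _ : Module (ZMod p) (G ⧸ H) := QuotientAddGroup.zmodModule hpG
  exact exists_basis_aux p H (QuotientAddGroup.mk' H) (QuotientAddGroup.mk'_surjective H)
    (QuotientAddGroup.ker_mk' H)

theorem exists_series {H : Type*} [AddCommGroup H] {f : H → ℝ} (hf : PN f) (D : AddSubgroup H)
    (hD : ∀ x : H, ∀ ε : ℝ, 0 < ε → ∃ y ∈ D, f (x - y) < ε) :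
    ∃ c : H → ℕ → D, (∀ x n, 1 ≤ n → f (c x n) ≤ 4 * (1 / 2) ^ n) ∧
      ∀ x, Filter.Tendsto (fun k => f (x - ∑ n ∈ Finset.range k, (c x n : H)))
        Filter.atTop (nhds 0) := by
  have h : ∀ x : H, ∀ n : ℕ, ∃ y : D, f (x - y) < (1 / 2) ^ n := by
    intro x n
    obtain ⟨y, hy, h⟩ := hD x ((1 / 2) ^ n) (by positivity)
    exact ⟨⟨y, hy⟩, h⟩
  choose s hs using h
  let t : H → ℕ → D := fun x n => if n = 0 then 0 else s x n
  have hsum : ∀ x k, ∑ n ∈ Finset.range k, ((t x (n + 1) - t x n : D) : H) = t x k := by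
    intro x k
    have := Finset.sum_range_sub (fun n => (t x n : H)) k
    simpa [t] using this
  refine ⟨fun x n => t x (n + 1) - t x n, fun x n hn => ?_, fun x => ?_⟩
  · have h1 := hs x (n + 1)
    have h2 := hs x n
    have e : ((t x (n + 1) - t x n : D) : H) = (x - s x n) - (x - s x (n + 1)) := by
      have : n ≠ 0 := by omega
      simp [t, this]
    have h3 := hf.tri (x - s x n) (x - s x (n + 1))
    rw [e]
    rw [pow_succ] at h1
    have : (0 : ℝ) < (1 / 2) ^ n := by positivity
    linarith
  · simp only [hsum]
    refine squeeze_zero' (Filter.Eventually.of_forall fun k => hf.nonneg _)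
      (Filter.eventually_atTop.2 ⟨1, fun k hk => ?_⟩)
      (tendsto_pow_atTop_nhds_zero_of_lt_one (r := (1 / 2 : ℝ)) (by norm_num) (by norm_num))
    have : k ≠ 0 := by omega
    simpa [t, this] using (hs x k).le

theorem exists_dense {H : Type u} [AddCommGroup H] {f : H → ℝ} (hf : PN f) :
    ∃ D : AddSubgroup H, (∀ x : H, ∀ ε : ℝ, 0 < ε → ∃ y ∈ D, f (x - y) < ε) ∧
      ∀ κ : Cardinal.{u}, Cardinal.aleph0 ≤ κ →
        (∃ D : Set H, Cardinal.mk D ≤ κ ∧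
            ∀ x : H, ∀ ε : ℝ, 0 < ε → ∃ y ∈ D, f (x - y) < ε) → Cardinal.mk D ≤ κ := by
  let S : Set (Set H) := {D | ∀ x : H, ∀ ε : ℝ, 0 < ε → ∃ y ∈ D, f (x - y) < ε}
  have hS : S.Nonempty := ⟨Set.univ, fun x ε h => ⟨x, trivial, by simpa [hf.zero] using h⟩⟩
  let D := Function.argminOn (fun D : Set H => Cardinal.mk D) S hS
  have hD : D ∈ S := Function.argminOn_mem _ _ _
  refine ⟨AddSubgroup.closure D, fun x ε h => ?_, fun κ hκ ⟨E, hE, hE'⟩ => ?_⟩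
  · obtain ⟨y, hy, h⟩ := hD x ε h
    exact ⟨y, AddSubgroup.subset_closure hy, h⟩
  · refine card_closure_le _ κ hκ (le_trans ?_ hE)
    exact Function.argminOn_le (fun D : Set H => Cardinal.mk D) S (a := E) hE'

end PNExt

open PNExt in
/-- Let `p` be a prime and `H` a subgroup of an abelian group `G` with `pG ⊆ H`. Then any
pseudonorm on `H` extends to a pseudonorm on `G` with the same density of the associated
pseudometric space. -/
theorem pseudonorm_extension_of_prime_index {G : Type u} [AddCommGroup G]
    (p : ℕ) (hp : p.Prime)
    (H : AddSubgroup G) (hpG : ∀ g : G, p • g ∈ H)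
    (fH : H → ℝ)
    (h0 : fH 0 = 0) (hnn : ∀ x, 0 ≤ fH x)
    (htri : ∀ x y, fH (x - y) ≤ fH x + fH y) :
    ∃ fG : G → ℝ, fG 0 = 0 ∧ (∀ x, 0 ≤ fG x) ∧
      (∀ x y, fG (x - y) ≤ fG x + fG y) ∧
      (∀ x : H, fG (x : G) = fH x) ∧
      ∀ κ : Cardinal.{u}, Cardinal.aleph0 ≤ κ →
        ((∃ D : Set H, Cardinal.mk D ≤ κ ∧
            ∀ x : H, ∀ ε : ℝ, 0 < ε → ∃ y ∈ D, fH (x - y) < ε) ↔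
         (∃ D : Set G, Cardinal.mk D ≤ κ ∧
            ∀ x : G, ∀ ε : ℝ, 0 < ε → ∃ y ∈ D, fG (x - y) < ε)) := by
  classical
  have hf : PN fH := ⟨h0, hnn, htri⟩
  obtain ⟨ι, b, hspan, hind⟩ := exists_basis p hp H hpG
  obtain ⟨D, hD, hDmin⟩ := exists_dense hf
  obtain ⟨c', hcb', hct'⟩ := exists_series hf D hD
  let x : ι → H := fun i => ⟨p • b i, hpG _⟩
  let cD : ι → ℕ → D := fun i n => c' (x i) n
  let c : ι → ℕ → H := fun i n => cD i n
  have hcb : ∀ i n, 1 ≤ n → fH (c i n) ≤ 4 * (1 / 2) ^ n := fun i n hn => hcb' (x i) n hn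
  have hct : ∀ i, Filter.Tendsto (fun k => fH (x i - ∑ n ∈ Finset.range k, c i n))
        Filter.atTop (nhds 0) := fun i => hct' (x i)
  have hc : ∀ i, Summable fun n => fH (c i n) := by
    intro i
    rw [← summable_nat_add_iff 1]
    refine Summable.of_nonneg_of_le (fun n => hnn _) (fun n => hcb i (n + 1) (by omega)) ?_
    exact (summable_nat_add_iff 1).2 (summable_geometric_two.mul_left 4)
  -- the combination map
  let φ : (ι →₀ ℤ) →+ G := (Finsupp.linearCombination ℤ b).toAddMonoidHom
  have hφ : ∀ l, φ l = l.sum fun i z => z • b i := fun l => rfl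
  have key : ∀ (h : H) (l : ι →₀ ℤ), φ l = h → fH h ≤ N c fH l := by
    intro h l hl
    obtain ⟨m, rfl⟩ := hind l (by rw [← hφ, hl]; exact h.2)
    have h1 : h = m.sum fun i z => z • x i := by
      apply Subtype.ext
      rw [← hl, map_nsmul, hφ, Finsupp.sum, Finsupp.sum, Finset.smul_sum,
        AddSubgroup.val_finsetSum]
      refine Finset.sum_congr rfl fun i _ => ?_
      simp only [x, AddSubgroup.coe_zsmul]
      rw [smul_comm]
    rw [h1, N_nsmul]
    refine (le_N hf hc x hct m).trans ?_
    have : (1 : ℝ) ≤ p := by exact_mod_cast hp.one_le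
    nlinarith [N_nonneg (c := c) hf m]
  let S : G → Set ℝ := fun g => {r | ∃ (h : H) (l : ι →₀ ℤ), g = h + φ l ∧ r = fH h + N c fH l}
  have hSpos : ∀ g, ∀ r ∈ S g, 0 ≤ r := by
    rintro g r ⟨h, l, -, rfl⟩
    exact add_nonneg (hnn _) (N_nonneg hf _)
  have hSne : ∀ g, (S g).Nonempty := by
    intro g
    obtain ⟨h, l, e⟩ := hspan g
    exact ⟨_, h, l, e, rfl⟩
  let fG : G → ℝ := fun g => sInf (S g)
  have hle : ∀ (h : H) (l : ι →₀ ℤ), fG (h + φ l) ≤ fH h + N c fH l := fun h l =>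
    csInf_le ⟨0, fun r hr => hSpos _ r hr⟩ ⟨h, l, rfl, rfl⟩
  have hex : ∀ g ε, 0 < ε → ∃ (h : H) (l : ι →₀ ℤ), g = h + φ l ∧ fH h + N c fH l < fG g + ε := by
    intro g ε hε
    obtain ⟨r, ⟨h, l, e, rfl⟩, hr⟩ := exists_lt_of_csInf_lt (hSne g) (lt_add_of_pos_right (fG g) hε)
    exact ⟨h, l, e, hr⟩
  have hGnn : ∀ g, 0 ≤ fG g := fun g => le_csInf (hSne g) (hSpos g)
  have hGle : ∀ h : H, fG h ≤ fH h := by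
    intro h
    simpa [N_zero] using hle h 0
  have hGext : ∀ h : H, fG h = fH h := by
    intro h
    refine le_antisymm (hGle h) (le_csInf (hSne _) ?_)
    rintro r ⟨h', l, e, rfl⟩
    have h1 := key (h - h') l (by rw [AddSubgroup.coe_sub, e]; abel)
    have h2 := hf.add h' (h - h')
    rw [add_sub_cancel] at h2
    linarith
  have hG : PN fG := by
    refine ⟨by simpa [h0] using hGext 0, hGnn, fun g g' => ?_⟩
    refine le_of_forall_pos_le_add fun ε hε => ?_
    obtain ⟨h, l, e, hr⟩ := hex g (ε / 2) (by positivity)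
    obtain ⟨h', l', e', hr'⟩ := hex g' (ε / 2) (by positivity)
    have h1 := hle (h - h') (l - l')
    have h2 : ((h - h' : H) : G) + φ (l - l') = g - g' := by
      rw [e, e', AddSubgroup.coe_sub, map_sub]; abel
    rw [h2] at h1
    linarith [htri h h', N_sub hf hc l l']
  refine ⟨fG, hG.zero, hGnn, hG.tri, hGext, fun κ hκ => ⟨fun hdense => ?_, ?_⟩⟩
  · have hDκ := hDmin κ hκ hdense
    -- choose representatives of the cells
    let P : List D → Set ι := fun L => {i | List.ofFn (fun j : Fin L.length => cD i j) = L}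
    let B₀ : Set G := {g | ∃ L : List D, ∃ h : (P L).Nonempty, b h.some = g}
    have hB₀ : Cardinal.mk B₀ ≤ κ := by
      have : B₀ ⊆ Set.range (fun L : List D => if h : (P L).Nonempty then b h.some else 0) := by
        rintro g ⟨L, h, rfl⟩
        exact ⟨L, by simp [h]⟩
      refine (Cardinal.mk_le_mk_of_subset this).trans (Cardinal.mk_range_le.trans ?_)
      exact (Cardinal.mk_list_le_max _).trans (max_le hκ hDκ)
    let D₁ : Set G := (fun d : H => (d : G)) '' (D : Set H)
    have hD₁ : Cardinal.mk D₁ ≤ κ := Cardinal.mk_image_le.trans hDκ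
    let T : AddSubgroup G := AddSubgroup.closure (D₁ ∪ B₀)
    refine ⟨T, card_closure_le _ κ hκ ((Cardinal.mk_union_le _ _).trans
      (Cardinal.add_le_of_le hκ hD₁ hB₀)), ?_⟩
    let C : AddSubgroup G :=
      { carrier := {g | ∀ ε : ℝ, 0 < ε → ∃ y ∈ T, fG (g - y) < ε}
        zero_mem' := fun ε hε => ⟨0, T.zero_mem, by simpa [hG.zero] using hε⟩
        add_mem' := by
          intro g g' hg hg' ε hε
          obtain ⟨y, hy, h⟩ := hg (ε / 2) (by positivity)
          obtain ⟨y', hy', h'⟩ := hg' (ε / 2) (by positivity)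
          refine ⟨y + y', T.add_mem hy hy', ?_⟩
          have := hG.add (g - y) (g' - y')
          rw [add_sub_add_comm]
          linarith
        neg_mem' := by
          intro g hg ε hε
          obtain ⟨y, hy, h⟩ := hg ε hε
          refine ⟨-y, T.neg_mem hy, ?_⟩
          rw [← hG.neg]
          have : -(-g - -y) = g - y := by abel
          rwa [this] }
    have hHC : ∀ h : H, (h : G) ∈ C := by
      intro h ε hε
      obtain ⟨y, hy, hlt⟩ := hD h ε hε
      refine ⟨y, AddSubgroup.subset_closure (Or.inl ⟨y, hy, rfl⟩), ?_⟩
      rw [← AddSubgroup.coe_sub, hGext]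
      exact hlt
    have hbC : ∀ i, b i ∈ C := by
      intro i ε hε
      obtain ⟨k, hk⟩ := exists_pow_lt_of_lt_one (show 0 < ε / 16 by positivity)
        (show (1 / 2 : ℝ) < 1 by norm_num)
      let L : List D := List.ofFn (fun j : Fin (k + 1) => cD i j)
      have hlen : L.length = k + 1 := by simp [L]
      have hi : i ∈ P L := by
        apply List.ext_getElem <;> simp [L]
      have hne : (P L).Nonempty := ⟨i, hi⟩
      refine ⟨b hne.some, AddSubgroup.subset_closure (Or.inr ⟨L, hne, rfl⟩), ?_⟩
      have hj : List.ofFn (fun j : Fin L.length => cD hne.some j) = L := hne.some_mem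
      generalize hne.some = j at hj
      have hagree : ∀ n < k + 1, c i n = c j n := by
        intro n hn
        have h1 : L[n]'(by omega) = cD i n := by
          simp only [L, List.getElem_ofFn]
        have h2 : (List.ofFn (fun m : Fin L.length => cD j m))[n]'(by simp; omega) = cD j n := by
          simp
        have h3 : cD i n = cD j n := by
          rw [← h1, ← h2]
          congr 1
          exact hj.symm
        exact congrArg (fun d : D => (d : H)) h3
      have h1 := N_pair hf hc hcb (k + 1) (by omega) i j hagree
      have h2 := hle 0 (Finsupp.single i 1 - Finsupp.single j 1)
      have h3 : ((0 : H) : G) + φ (Finsupp.single i 1 - Finsupp.single j 1) = b i - b j := by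
        rw [map_sub, hφ, hφ]; simp
      rw [h3, h0] at h2
      rw [pow_succ] at h1
      have : (0 : ℝ) < (1 / 2) ^ k := by positivity
      linarith
    intro g
    have : g ∈ C := by
      obtain ⟨h, l, rfl⟩ := hspan g
      exact C.add_mem (hHC h) (C.sum_mem fun i _ => C.zsmul_mem (hbC i) _)
    exact this
  · rintro ⟨E, hE, hEd⟩
    let Q : E × ℕ → Set H := fun q => {h | fG ((h : G) - q.1) < 1 / ((q.2 : ℝ) + 1)}
    let r : E × ℕ → H := fun q => if h : (Q q).Nonempty then h.some else 0
    refine ⟨Set.range r, Cardinal.mk_range_le.trans ?_, fun y ε hε => ?_⟩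
    · rw [Cardinal.mk_prod]
      simp only [Cardinal.lift_uzero]
      refine Cardinal.mul_le_of_le hκ hE ?_
      simpa using hκ
    · obtain ⟨n, hn⟩ := exists_nat_one_div_lt (show 0 < ε / 2 by positivity)
      obtain ⟨e, he, hlt⟩ := hEd y (1 / ((n : ℝ) + 1)) (by positivity)
      have hne : (Q (⟨e, he⟩, n)).Nonempty := ⟨y, hlt⟩
      refine ⟨r (⟨e, he⟩, n), ⟨_, rfl⟩, ?_⟩
      have hr : fG ((r (⟨e, he⟩, n) : G) - e) < 1 / ((n : ℝ) + 1) := by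
        have : r (⟨e, he⟩, n) = hne.some := by simp [r, hne]
        rw [this]
        exact hne.some_mem
      have h1 := hG.tri ((y : G) - e) ((r (⟨e, he⟩, n) : G) - e)
      rw [sub_sub_sub_cancel_right, ← AddSubgroup.coe_sub, hGext] at h1
      linarith
end

section
/- Let G be an abelian group and H a subgroup of G such that the quotient group G/H is periodic (every element of G/H has finite order; equivalently, for every g ∈ G there is a positive integer n with n·g ∈ H). Then any pseudonorm |·|_H on H can be extended to a pseudonorm |·|_G on G such that for every infinite cardinal κ, the pseudometric space (H, d_H) with d_H(x,y) = |x−y|_H has a dense subset of cardinality ≤ κ if and only if the pseudometric space (G, d_G) with d_G(x,y) = |x−y|_G has a dense subset of cardinality ≤ κ. -/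
section PsAux
variable {A : Type*} [AddCommGroup A] {f : A → ℝ}

theorem ps_neg (h0 : f 0 = 0) (htri : ∀ x y, f (x - y) ≤ f x + f y) (x : A) :
    f (-x) = f x := by
  have h : ∀ y, f (-y) ≤ f y := fun y => by simpa [h0] using htri 0 y
  apply le_antisymm (h x)
  simpa using h (-x)

theorem ps_add (h0 : f 0 = 0) (htri : ∀ x y, f (x - y) ≤ f x + f y) (x y : A) :
    f (x + y) ≤ f x + f y := by
  have := htri x (-y)
  rwa [sub_neg_eq_add, ps_neg h0 htri] at this

theorem ps_sum (h0 : f 0 = 0) (htri : ∀ x y, f (x - y) ≤ f x + f y) {ι : Type*}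
    (s : Finset ι) (g : ι → A) : f (∑ i ∈ s, g i) ≤ ∑ i ∈ s, f (g i) := by
  classical
  induction s using Finset.induction_on with
  | empty => simp [h0]
  | insert a s ha ih =>
    rw [Finset.sum_insert ha, Finset.sum_insert ha]
    exact (ps_add h0 htri _ _).trans (by gcongr)

/-- integrality of transport, with integral row and column sums -/
theorem ps_core_nat (h0 : f 0 = 0)
    (htri : ∀ x y, f (x - y) ≤ f x + f y) {V : Type*} [Fintype V]
    (pt : V → A) (c : V → V → ℝ) (hc : ∀ x y, 0 ≤ c x y) (R C : V → ℕ)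
    (hR : ∀ x, ∑ y, c x y = R x) (hC : ∀ y, ∑ x, c x y = C y) :
    f (∑ x, R x • pt x - ∑ x, C x • pt x) ≤ ∑ x, ∑ y, c x y * f (pt x - pt y) := by
  classical
  have hcR : ∀ x y, R x = 0 → c x y = 0 := by
    intro x y h
    have := hR x
    rw [h, Nat.cast_zero, Finset.sum_eq_zero_iff_of_nonneg (fun y _ => hc x y)] at this
    exact this y (Finset.mem_univ _)
  have hcC : ∀ x y, C y = 0 → c x y = 0 := by
    intro x y h
    have := hC y
    rw [h, Nat.cast_zero, Finset.sum_eq_zero_iff_of_nonneg (fun x _ => hc x y)] at this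
    exact this x (Finset.mem_univ _)
  have hcard : ∑ x, R x = ∑ x, C x := by
    have : (∑ x, (R x : ℝ)) = ∑ x, (C x : ℝ) := by
      simp_rw [← hR, ← hC]
      exact Finset.sum_comm
    exact_mod_cast this
  let I := Σ x, Fin (R x)
  let J := Σ x, Fin (C x)
  have e : I ≃ J := Fintype.equivOfCardEq (by simp [I, J, hcard])
  have sumI : ∀ g : V → ℝ, ∑ i : I, g i.1 = ∑ x, R x * g x := by
    intro g
    rw [Fintype.sum_sigma]
    simp
  have sumJ : ∀ g : V → ℝ, ∑ i : I, g (e i).1 = ∑ x, C x * g x := by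
    intro g
    rw [Equiv.sum_comp e (fun j => g j.1), Fintype.sum_sigma]
    simp
  have sumIA : ∑ i : I, pt i.1 = ∑ x, R x • pt x := by
    rw [Fintype.sum_sigma]
    simp
  have sumJA : ∑ i : I, pt (e i).1 = ∑ x, C x • pt x := by
    rw [Equiv.sum_comp e (fun j => pt j.1), Fintype.sum_sigma]
    simp
  let M : Matrix I I ℝ := fun i j => c i.1 (e j).1 / (R i.1 * C (e j).1)
  have hM : M ∈ doublyStochastic ℝ I := by
    rw [mem_doublyStochastic_iff_sum]
    refine ⟨fun i j => div_nonneg (hc _ _) (by positivity), fun i => ?_, fun j => ?_⟩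
    · have hi : R i.1 ≠ 0 := by
        have := i.2.2
        omega
      have hi' : (R i.1 : ℝ) ≠ 0 := by exact_mod_cast hi
      have := sumJ (fun v => c i.1 v / (R i.1 * C v))
      change ∑ j : I, c i.1 (e j).1 / (R i.1 * C (e j).1) = 1
      rw [this]
      have : ∀ v, (C v : ℝ) * (c i.1 v / (R i.1 * C v)) = c i.1 v / R i.1 := by
        intro v
        by_cases hv : C v = 0
        · simp [hv, hcC _ v hv]
        · have hv' : (C v : ℝ) ≠ 0 := by exact_mod_cast hv
          field_simp
      simp_rw [this]
      rw [← Finset.sum_div, hR, div_self hi']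
    · have hj : C (e j).1 ≠ 0 := by
        have := (e j).2.2
        omega
      have hj' : (C (e j).1 : ℝ) ≠ 0 := by exact_mod_cast hj
      have := sumI (fun v => c v (e j).1 / (R v * C (e j).1))
      change ∑ i : I, c i.1 (e j).1 / (R i.1 * C (e j).1) = 1
      rw [this]
      have : ∀ v, (R v : ℝ) * (c v (e j).1 / (R v * C (e j).1)) = c v (e j).1 / C (e j).1 := by
        intro v
        by_cases hv : R v = 0
        · simp [hv, hcR v _ hv]
        · have hv' : (R v : ℝ) ≠ 0 := by exact_mod_cast hv
          field_simp
      simp_rw [this]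
      rw [← Finset.sum_div, hC, div_self hj']
  have hcost : ∑ i, ∑ j, M i j * f (pt i.1 - pt (e j).1)
      = ∑ x, ∑ y, c x y * f (pt x - pt y) := by
    have h1 : ∀ i : I, ∑ j, M i j * f (pt i.1 - pt (e j).1)
        = ∑ y, C y * (c i.1 y / (R i.1 * C y) * f (pt i.1 - pt y)) := fun i =>
      sumJ (fun y => c i.1 y / (R i.1 * C y) * f (pt i.1 - pt y))
    simp_rw [h1]
    rw [sumI (fun x => ∑ y, C y * (c x y / (R x * C y) * f (pt x - pt y)))]
    refine Finset.sum_congr rfl fun x _ => ?_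
    rw [Finset.mul_sum]
    refine Finset.sum_congr rfl fun y _ => ?_
    by_cases hx : R x = 0
    · simp [hx, hcR x _ hx]
    by_cases hy : C y = 0
    · simp [hy, hcC _ y hy]
    have hx' : (R x : ℝ) ≠ 0 := by exact_mod_cast hx
    have hy' : (C y : ℝ) ≠ 0 := by exact_mod_cast hy
    field_simp
  obtain ⟨w, hw0, hw1, hwM⟩ := exists_eq_sum_perm_of_mem_doublyStochastic hM
  rw [← hcost]
  have hper : ∀ σ : Equiv.Perm I, f (∑ x, R x • pt x - ∑ x, C x • pt x) ≤
      ∑ i, ∑ j, σ.permMatrix ℝ i j * f (pt i.1 - pt (e j).1) := by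
    intro σ
    have : ∀ i : I, ∑ j, σ.permMatrix ℝ i j * f (pt i.1 - pt (e j).1)
        = f (pt i.1 - pt (e (σ i)).1) := by
      intro i
      rw [Finset.sum_eq_single (σ i)]
      · simp [Equiv.Perm.permMatrix, PEquiv.toMatrix_apply]
      · intro j _ hj
        simp [Equiv.Perm.permMatrix, PEquiv.toMatrix_apply, hj.symm]
      · simp
    simp_rw [this]
    rw [← sumIA, ← sumJA, ← Equiv.sum_comp σ (fun i => pt (e i).1), ← Finset.sum_sub_distrib]
    exact ps_sum h0 htri _ _
  calc f (∑ x, R x • pt x - ∑ x, C x • pt x)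
      = ∑ σ, w σ * f (∑ x, R x • pt x - ∑ x, C x • pt x) := by
        rw [← Finset.sum_mul, hw1, one_mul]
    _ ≤ ∑ σ, w σ * ∑ i, ∑ j, σ.permMatrix ℝ i j * f (pt i.1 - pt (e j).1) :=
        Finset.sum_le_sum fun σ _ => mul_le_mul_of_nonneg_left (hper σ) (hw0 σ)
    _ = ∑ i, ∑ j, M i j * f (pt i.1 - pt (e j).1) := by
        rw [← hwM]
        simp_rw [Matrix.sum_apply, Matrix.smul_apply, Finset.sum_mul, Finset.mul_sum]
        rw [Finset.sum_comm]
        refine Finset.sum_congr rfl fun i _ => ?_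
        rw [Finset.sum_comm]
        simp

theorem ps_core (h0 : f 0 = 0)
    (htri : ∀ x y, f (x - y) ≤ f x + f y) {V : Type*} [Fintype V]
    (pt : V → A) (c : V → V → ℝ) (hc : ∀ x y, 0 ≤ c x y) (k : V → ℤ)
    (hk : ∀ x, ∑ y, c x y - ∑ y, c y x = k x) :
    f (∑ x, k x • pt x) ≤ ∑ x, ∑ y, c x y * f (pt x - pt y) := by
  classical
  let R : V → ℕ := fun x => ⌈∑ y, c x y⌉₊
  have hRle : ∀ x, ∑ y, c x y ≤ R x := fun x => Nat.le_ceil _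
  let c' : V → V → ℝ := fun x y => c x y + if x = y then (R x - ∑ z, c x z) else 0
  have hc' : ∀ x y, 0 ≤ c' x y := by
    intro x y
    have := hc x y
    have := hRle x
    simp only [c']
    split_ifs <;> linarith
  have hrow : ∀ x, ∑ y, c' x y = R x := by
    intro x
    simp [c', Finset.sum_add_distrib]
  have hcol : ∀ y, ∑ x, c' x y = R y - k y := by
    intro y
    simp only [c', Finset.sum_add_distrib]
    simp [← hk]
    ring
  have hnn : ∀ y, (0 : ℤ) ≤ R y - k y := by
    intro y
    have : (0 : ℝ) ≤ R y - k y := by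
      rw [← hcol]
      exact Finset.sum_nonneg fun x _ => hc' x y
    exact_mod_cast this
  have key := ps_core_nat h0 htri pt c' hc' R (fun y => (R y - k y : ℤ).toNat) hrow (by
    intro y
    rw [hcol]
    have : (((R y - k y : ℤ).toNat : ℤ) : ℝ) = ((R y - k y : ℤ) : ℝ) := by
      rw [Int.toNat_of_nonneg (hnn y)]
    push_cast at this
    exact this.symm)
  have e1 : ∑ x, R x • pt x - ∑ y, (R y - k y : ℤ).toNat • pt y = ∑ x, k x • pt x := by
    rw [← Finset.sum_sub_distrib]
    refine Finset.sum_congr rfl fun x _ => ?_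
    rw [← natCast_zsmul, ← natCast_zsmul, Int.toNat_of_nonneg (hnn x), sub_zsmul]
    abel
  rw [e1] at key
  refine key.trans (le_of_eq ?_)
  refine Finset.sum_congr rfl fun x _ => ?_
  simp [c', add_mul, Finset.sum_add_distrib, h0]


/-- boundary of a flow -/
noncomputable def psBd (A : Type*) [AddCommGroup A] : (A × A →₀ ℚ) →+ (A →₀ ℚ) :=
  Finsupp.mapDomain.addMonoidHom Prod.fst - Finsupp.mapDomain.addMonoidHom Prod.snd

noncomputable def psCast (A : Type*) [AddCommGroup A] : (A →₀ ℤ) →+ (A →₀ ℚ) :=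
  Finsupp.mapRange.addMonoidHom (Int.castAddHom ℚ)

noncomputable def psSum (A : Type*) [AddCommGroup A] : (A →₀ ℤ) →+ A :=
  Finsupp.liftAddHom (fun a => (zmultiplesHom A a))

noncomputable def psCost (f : A → ℝ) (F : A × A →₀ ℚ) : ℝ :=
  F.sum fun p c => |(c : ℝ)| * f (p.1 - p.2)

theorem psBd_single (p : A × A) (c : ℚ) :
    psBd A (Finsupp.single p c) = Finsupp.single p.1 c - Finsupp.single p.2 c := by
  simp [psBd, Finsupp.mapDomain_single]

theorem psCast_single (a : A) (n : ℤ) :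
    psCast A (Finsupp.single a n) = Finsupp.single a (n : ℚ) := by
  simp [psCast]

theorem psSum_single (a : A) (n : ℤ) : psSum A (Finsupp.single a n) = n • a := by
  simp [psSum]

theorem psCost_single (f : A → ℝ) (p : A × A) (c : ℚ) :
    psCost f (Finsupp.single p c) = |(c : ℝ)| * f (p.1 - p.2) := by
  simp [psCost]

theorem psCost_nonneg (hnn : ∀ x, 0 ≤ f x) (F : A × A →₀ ℚ) : 0 ≤ psCost f F :=
  Finset.sum_nonneg fun _ _ => mul_nonneg (abs_nonneg _) (hnn _)

theorem psCost_sub (hnn : ∀ x, 0 ≤ f x) (F F' : A × A →₀ ℚ) :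
    psCost f (F - F') ≤ psCost f F + psCost f F' := by
  classical
  have h : ∀ E : A × A →₀ ℚ, E.support ⊆ F.support ∪ F'.support →
      psCost f E = ∑ p ∈ F.support ∪ F'.support, |(E p : ℝ)| * f (p.1 - p.2) := by
    intro E hE
    exact Finsupp.sum_of_support_subset _ hE _ (by simp)
  rw [h F Finset.subset_union_left, h F' Finset.subset_union_right,
    h (F - F') Finsupp.support_sub, ← Finset.sum_add_distrib]
  refine Finset.sum_le_sum fun p _ => ?_
  rw [← add_mul]
  refine mul_le_mul_of_nonneg_right ?_ (hnn _)
  simpa using abs_sub (F p : ℝ) (F' p : ℝ)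

theorem ps_transport (h0 : f 0 = 0) 
    (htri : ∀ x y, f (x - y) ≤ f x + f y) (F : A × A →₀ ℚ) (k : A →₀ ℤ)
    (hk : psBd A F = psCast A k) : f (psSum A k) ≤ psCost f F := by
  classical
  let T : Finset A := F.support.image Prod.fst ∪ F.support.image Prod.snd ∪ k.support
  have hT : F.support ⊆ T ×ˢ T := by
    intro p hp
    simp only [T, Finset.mem_product, Finset.mem_union, Finset.mem_image]
    exact ⟨Or.inl (Or.inl ⟨p, hp, rfl⟩), Or.inl (Or.inr ⟨p, hp, rfl⟩)⟩
  have hfst : ∀ x ∈ T, Finsupp.mapDomain Prod.fst F x = ∑ y ∈ T, F (x, y) := by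
    intro x hx
    rw [Finsupp.mapDomain, Finsupp.sum_of_support_subset _ hT _ (by simp),
      Finset.sum_product, Finsupp.finsetSum_apply, Finset.sum_eq_single_of_mem x hx]
    · simp [Finsupp.finsetSum_apply]
    · intro b _ hb
      simp [Finsupp.finsetSum_apply, Finsupp.single_apply, hb]
  have hsnd : ∀ x ∈ T, Finsupp.mapDomain Prod.snd F x = ∑ y ∈ T, F (y, x) := by
    intro x hx
    rw [Finsupp.mapDomain, Finsupp.sum_of_support_subset _ hT _ (by simp),
      Finset.sum_product_right, Finsupp.finsetSum_apply, Finset.sum_eq_single_of_mem x hx]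
    · simp [Finsupp.finsetSum_apply]
    · intro b _ hb
      simp [Finsupp.finsetSum_apply, Finsupp.single_apply, hb]
  have hdiff : ∀ x ∈ T, (∑ y ∈ T, F (x, y)) - ∑ y ∈ T, F (y, x) = (k x : ℚ) := by
    intro x hx
    have := DFunLike.congr_fun hk x
    rw [← hfst x hx, ← hsnd x hx]
    simpa [psBd, psCast] using this
  have hS : psSum A k = ∑ x : T, k x • (x : A) := by
    rw [Finset.sum_coe_sort T (fun x => k x • x)]
    simp only [psSum, Finsupp.liftAddHom_apply]
    rw [Finsupp.sum_of_support_subset _ (show k.support ⊆ T from Finset.subset_union_right) _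
      (by simp)]
    simp
  let pos : ℚ → ℝ := fun c => max (c : ℝ) 0
  let neg : ℚ → ℝ := fun c => max (-(c : ℝ)) 0
  have hpn : ∀ c, pos c - neg c = c := fun c => max_zero_sub_max_neg_zero_eq_self _
  have hpa : ∀ c, pos c + neg c = |(c : ℝ)| := fun c => max_zero_add_max_neg_zero_eq_abs_self _
  have hC : psCost f F = ∑ x : T, ∑ y : T,
      (pos (F (x, y)) + neg (F (y, x))) * f ((x : A) - y) := by
    rw [Finset.sum_coe_sort T (fun x => ∑ y : T, (pos (F (x, y)) + neg (F (y, x))) * f (x - y))]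
    have : ∀ x, ∑ y : T, (pos (F (x, y)) + neg (F (y, x))) * f (x - y)
      = ∑ y ∈ T, (pos (F (x, y)) + neg (F (y, x))) * f (x - y) := fun x =>
      Finset.sum_coe_sort T (fun y => (pos (F (x, y)) + neg (F (y, x))) * f (x - y))
    simp_rw [this, add_mul, Finset.sum_add_distrib]
    rw [psCost, Finsupp.sum_of_support_subset _ hT _ (by simp), Finset.sum_product]
    rw [Finset.sum_comm (f := fun x y => neg (F (y, x)) * f (x - y))]
    rw [← Finset.sum_add_distrib]
    refine Finset.sum_congr rfl fun x _ => ?_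
    rw [← Finset.sum_add_distrib]
    refine Finset.sum_congr rfl fun y _ => ?_
    rw [← hpa, add_mul, ← neg_sub x y, ps_neg h0 htri]
  rw [hS, hC]
  refine ps_core h0 htri (fun x : T => (x : A))
    (fun x y => pos (F (x, y)) + neg (F (y, x))) (fun x y => ?_) (fun x => k x) (fun x => ?_)
  · exact add_nonneg (le_max_right _ _) (le_max_right _ _)
  · rw [← Finset.sum_sub_distrib]
    have h1 : ∀ y : T, pos (F (x, y)) + neg (F (y, x)) - (pos (F (y, x)) + neg (F (x, y)))
        = (F (x, y) : ℝ) - (F (y, x) : ℝ) := by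
      intro y
      rw [← hpn, ← hpn (F (y, x))]
      ring
    simp_rw [h1]
    rw [Finset.sum_coe_sort T (fun y => (F (x, y) : ℝ) - (F (y, x) : ℝ)),
      Finset.sum_sub_distrib]
    exact_mod_cast hdiff x x.2

/-- flows with integral boundary and vanishing evaluation -/
noncomputable def psRel (A : Type*) [AddCommGroup A] : AddSubgroup (A × A →₀ ℚ) :=
  ((psSum A).ker.map (psCast A)).comap (psBd A)

theorem mem_psRel {F : A × A →₀ ℚ} :
    F ∈ psRel A ↔ ∃ k : A →₀ ℤ, psSum A k = 0 ∧ psCast A k = psBd A F := by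
  simp [psRel, AddSubgroup.mem_map, AddMonoidHom.mem_ker]

abbrev PsX (A : Type*) [AddCommGroup A] := (A × A →₀ ℚ) ⧸ psRel A

noncomputable def psNorm (f : A → ℝ) (x : PsX A) : ℝ :=
  sInf (psCost f '' {F | (QuotientAddGroup.mk F : PsX A) = x})

theorem psNorm_le (hnn : ∀ x, 0 ≤ f x) (F : A × A →₀ ℚ) :
    psNorm f (QuotientAddGroup.mk F : PsX A) ≤ psCost f F :=
  csInf_le ⟨0, by rintro _ ⟨F, _, rfl⟩; exact psCost_nonneg hnn F⟩ ⟨F, rfl, rfl⟩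

theorem le_psNorm {x : PsX A} {b : ℝ}
    (h : ∀ F, (QuotientAddGroup.mk F : PsX A) = x → b ≤ psCost f F) : b ≤ psNorm f x := by
  refine le_csInf ?_ ?_
  · obtain ⟨F, rfl⟩ := QuotientAddGroup.mk_surjective x
    exact ⟨_, F, rfl, rfl⟩
  · rintro _ ⟨F, hF, rfl⟩
    exact h F hF

theorem psNorm_nonneg (hnn : ∀ x, 0 ≤ f x) (x : PsX A) : 0 ≤ psNorm f x :=
  le_psNorm fun F _ => psCost_nonneg hnn F

theorem psNorm_zero (hnn : ∀ x, 0 ≤ f x) : psNorm f (0 : PsX A) = 0 := by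
  refine le_antisymm ?_ (psNorm_nonneg hnn _)
  simpa [psCost] using psNorm_le hnn (0 : A × A →₀ ℚ)

theorem psNorm_sub (hnn : ∀ x, 0 ≤ f x) (x y : PsX A) :
    psNorm f (x - y) ≤ psNorm f x + psNorm f y := by
  rw [← sub_le_iff_le_add]
  refine le_psNorm fun F hF => ?_
  rw [sub_le_iff_le_add, add_comm, ← sub_le_iff_le_add]
  refine le_psNorm fun F' hF' => ?_
  rw [sub_le_iff_le_add, add_comm]
  refine le_trans ?_ (psCost_sub hnn F F')
  rw [← hF, ← hF', ← QuotientAddGroup.mk_sub]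
  exact psNorm_le hnn _

noncomputable def psEmb (A : Type*) [AddCommGroup A] : A →+ PsX A :=
  AddMonoidHom.mk' (fun a => QuotientAddGroup.mk (Finsupp.single (a, 0) 1)) (by
    intro a b
    rw [← QuotientAddGroup.mk_add, QuotientAddGroup.eq, mem_psRel]
    refine ⟨Finsupp.single a 1 + Finsupp.single b 1 - Finsupp.single (a + b) 1
      - Finsupp.single 0 1, ?_, ?_⟩
    · simp [psSum_single]
    · simp only [map_add, map_sub, map_neg, psCast_single, psBd_single, Int.cast_one]
      abel)

theorem psEmb_apply (a : A) : psEmb A a = QuotientAddGroup.mk (Finsupp.single (a, 0) 1) := rfl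

theorem psNorm_emb (h0 : f 0 = 0) (hnn : ∀ x, 0 ≤ f x)
    (htri : ∀ x y, f (x - y) ≤ f x + f y) (a : A) : psNorm f (psEmb A a) = f a := by
  apply le_antisymm
  · refine (psNorm_le hnn _).trans ?_
    simp [psCost_single]
  · refine le_psNorm fun F hF => ?_
    rw [psEmb_apply, QuotientAddGroup.eq, mem_psRel] at hF
    obtain ⟨k, hk, hk'⟩ := hF
    have := ps_transport h0 htri F (Finsupp.single a 1 - Finsupp.single 0 1 - k) (by
      rw [map_sub, hk', map_sub, map_add, map_neg, psCast_single, psCast_single, psBd_single]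
      simp)
    simpa [hk, psSum_single] using this

theorem psX_smul_surj (n : ℤ) (hn : n ≠ 0) (x : PsX A) : ∃ y : PsX A, n • y = x := by
  obtain ⟨F, rfl⟩ := QuotientAddGroup.mk_surjective x
  refine ⟨QuotientAddGroup.mk ((n : ℚ)⁻¹ • F), ?_⟩
  rw [← QuotientAddGroup.mk_zsmul]
  congr 1
  ext p
  have : (n : ℚ) ≠ 0 := by exact_mod_cast hn
  simp [this]

/-- edges may be replaced by pairs of edges to the origin -/
theorem ps_edge (x y : A) (c : ℚ) : (QuotientAddGroup.mk (Finsupp.single (x, y) c) : PsX A)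
    = QuotientAddGroup.mk (Finsupp.single (x, 0) c)
      - QuotientAddGroup.mk (Finsupp.single (y, 0) c) := by
  rw [← QuotientAddGroup.mk_sub, QuotientAddGroup.eq, mem_psRel]
  refine ⟨0, by simp, ?_⟩
  simp only [map_add, map_sub, map_neg, map_zero, psBd_single]
  abel

theorem ps_approx (h0 : f 0 = 0) (hnn : ∀ x, 0 ≤ f x) (D : Set A)
    (hD : ∀ x : A, ∀ ε : ℝ, 0 < ε → ∃ y ∈ D, f (x - y) < ε) (x : PsX A) :
    ∀ ε : ℝ, 0 < ε → ∃ v : D →₀ ℚ, psNorm f (x - QuotientAddGroup.mk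
      (v.mapDomain (fun d : D => ((d : A), (0 : A))))) < ε := by
  have hXadd := ps_add (f := psNorm f (A := A)) (psNorm_zero hnn) (psNorm_sub hnn)
  have base : ∀ (a : A) (c : ℚ), ∀ ε : ℝ, 0 < ε → ∃ d : D, psNorm f
      ((QuotientAddGroup.mk (Finsupp.single (a, 0) c) : PsX A)
        - QuotientAddGroup.mk (Finsupp.single ((d : A), 0) c)) < ε := by
    intro a c ε hε
    obtain ⟨d, hd, hlt⟩ := hD a (ε / (|(c : ℝ)| + 1)) (by positivity)
    refine ⟨⟨d, hd⟩, ?_⟩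
    rw [← ps_edge]
    refine (psNorm_le hnn _).trans_lt ?_
    rw [psCost_single]
    rw [lt_div_iff₀ (by positivity)] at hlt
    have := hnn (a - d)
    simp only
    nlinarith
  obtain ⟨F, rfl⟩ := QuotientAddGroup.mk_surjective x
  induction F using Finsupp.induction_linear with
  | zero =>
    intro ε hε
    refine ⟨0, ?_⟩
    simpa [psNorm_zero hnn] using hε
  | add F F' ih ih' =>
    intro ε hε
    obtain ⟨v, hv⟩ := ih (ε / 2) (by positivity)
    obtain ⟨v', hv'⟩ := ih' (ε / 2) (by positivity)
    refine ⟨v + v', ?_⟩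
    rw [Finsupp.mapDomain_add, QuotientAddGroup.mk_add, QuotientAddGroup.mk_add,
      add_sub_add_comm]
    exact (hXadd _ _).trans_lt (by linarith)
  | single p c =>
    intro ε hε
    obtain ⟨d, hd⟩ := base p.1 c (ε / 2) (by positivity)
    obtain ⟨d', hd'⟩ := base p.2 c (ε / 2) (by positivity)
    refine ⟨Finsupp.single d c - Finsupp.single d' c, ?_⟩
    have e1 : Finsupp.mapDomain (fun d : D => ((d : A), (0 : A)))
        (Finsupp.single d c - Finsupp.single d' c)
        = Finsupp.single ((d : A), 0) c - Finsupp.single ((d' : A), 0) c := by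
      have := map_sub (Finsupp.mapDomain.addMonoidHom (M := ℚ)
        (fun d : D => ((d : A), (0 : A)))) (Finsupp.single d c) (Finsupp.single d' c)
      simpa [Finsupp.mapDomain_single] using this
    rw [e1, QuotientAddGroup.mk_sub, show p = (p.1, p.2) from rfl, ps_edge, sub_sub_sub_comm]
    exact (psNorm_sub hnn _ _).trans_lt (by simpa using add_lt_add hd hd')

end PsAux

theorem ps_density_pullback {A B : Type u} [AddCommGroup A] [AddCommGroup B] (φ : A →+ B)
    {n : B → ℝ} (h0 : n 0 = 0) (htri : ∀ x y, n (x - y) ≤ n x + n y)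
    (κ : Cardinal.{u}) (hκ : Cardinal.aleph0 ≤ κ) (D : Set B) (hDκ : Cardinal.mk D ≤ κ)
    (hD : ∀ x : B, ∀ ε : ℝ, 0 < ε → ∃ y ∈ D, n (x - y) < ε) :
    ∃ D' : Set A, Cardinal.mk D' ≤ κ ∧
      ∀ x : A, ∀ ε : ℝ, 0 < ε → ∃ y ∈ D', n (φ (x - y)) < ε := by
  classical
  let g : D × ℕ → A := fun p =>
    if h : ∃ a : A, n (φ a - p.1) < 1 / ((p.2 : ℝ) + 1) then h.choose else 0
  have hg : ∀ (p : D × ℕ) (a : A), n (φ a - p.1) < 1 / ((p.2 : ℝ) + 1) →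
      n (φ (g p) - p.1) < 1 / ((p.2 : ℝ) + 1) := by
    intro p a ha
    have h : ∃ a : A, n (φ a - p.1) < 1 / ((p.2 : ℝ) + 1) := ⟨a, ha⟩
    simp only [g, dif_pos h]
    exact h.choose_spec
  refine ⟨Set.range g, ?_, ?_⟩
  · refine Cardinal.mk_range_le.trans ?_
    rw [Cardinal.mk_prod]
    simp only [Cardinal.lift_uzero, Cardinal.mk_nat, Cardinal.lift_aleph0]
    exact Cardinal.mul_le_of_le hκ hDκ hκ
  · intro x ε hε
    obtain ⟨m, hm⟩ := exists_nat_one_div_lt (half_pos hε)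
    obtain ⟨y, hy, hlt⟩ := hD (φ x) (1 / ((m : ℝ) + 1)) (by positivity)
    refine ⟨g (⟨y, hy⟩, m), ⟨_, rfl⟩, ?_⟩
    have h1 := hg (⟨y, hy⟩, m) x hlt
    have h2 := htri (φ x - y) (φ (g (⟨y, hy⟩, m)) - y)
    rw [sub_sub_sub_cancel_right, ← map_sub] at h2
    simp only at h1
    linarith


/-- Let `H` be a subgroup of an abelian group `G` such that the quotient `G/H` is
periodic (for every `g ∈ G` there is a positive integer `n` with `n • g ∈ H`). Then any
pseudonorm on `H` extends to a pseudonorm on `G` with the same density of the associated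
pseudometric space. -/
theorem pseudonorm_extension_of_periodic_quotient {G : Type u} [AddCommGroup G]
    (H : AddSubgroup G) (hper : ∀ g : G, ∃ n : ℕ, 0 < n ∧ n • g ∈ H)
    (fH : H → ℝ)
    (h0 : fH 0 = 0) (hnn : ∀ x, 0 ≤ fH x)
    (htri : ∀ x y, fH (x - y) ≤ fH x + fH y) :
    ∃ fG : G → ℝ, fG 0 = 0 ∧ (∀ x, 0 ≤ fG x) ∧
      (∀ x y, fG (x - y) ≤ fG x + fG y) ∧
      (∀ x : H, fG (x : G) = fH x) ∧
      ∀ κ : Cardinal.{u}, Cardinal.aleph0 ≤ κ →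
        ((∃ D : Set H, Cardinal.mk D ≤ κ ∧
            ∀ x : H, ∀ ε : ℝ, 0 < ε → ∃ y ∈ D, fH (x - y) < ε) ↔
         (∃ D : Set G, Cardinal.mk D ≤ κ ∧
            ∀ x : G, ∀ ε : ℝ, 0 < ε → ∃ y ∈ D, fG (x - y) < ε)) := by
  obtain ⟨φ, hφ⟩ : ∃ φ : G →+ PsX H, ∀ x : H, φ x = psEmb H x := by
    haveI : DivisibleBy (PsX H) ℤ := 
      divisibleByOfSMulRightSurj (PsX H) ℤ (fun {n} hn x => psX_smul_surj n hn x)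
    obtain ⟨φ, hφ⟩ := (Module.Baer.of_divisible (PsX H)).extension_property_addMonoidHom
      H.subtype H.subtype_injective (psEmb H)
    exact ⟨φ, fun x => DFunLike.congr_fun hφ x⟩
  have hext : ∀ x : H, psNorm fH (φ (x : G)) = fH x := fun x => by
    rw [hφ, psNorm_emb h0 hnn htri]
  have hN0 : psNorm fH (0 : PsX H) = 0 := psNorm_zero hnn
  refine ⟨fun g => psNorm fH (φ g), by simpa using hN0, fun x => psNorm_nonneg hnn _,
    fun x y => by simpa using psNorm_sub hnn (φ x) (φ y), hext, fun κ hκ => ⟨?_, ?_⟩⟩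
  · rintro ⟨D, hDκ, hD⟩
    refine ps_density_pullback φ hN0 (psNorm_sub hnn) κ hκ
      (Set.range fun v : D →₀ ℚ => (QuotientAddGroup.mk
        (v.mapDomain (fun d : D => ((d : H), (0 : H)))) : PsX H)) ?_ ?_
    · refine Cardinal.mk_range_le.trans ?_
      rcases isEmpty_or_nonempty D with hE | hE
      · exact (Cardinal.mk_le_aleph0).trans hκ
      · rw [Cardinal.mk_finsupp_lift_of_infinite']
        simp only [Cardinal.lift_uzero, Cardinal.mkRat, Cardinal.lift_aleph0]
        exact max_le hDκ hκ
    · intro x ε hε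
      obtain ⟨v, hv⟩ := ps_approx h0 hnn D hD x ε hε
      exact ⟨_, ⟨v, rfl⟩, hv⟩
  · rintro ⟨D, hDκ, hD⟩
    obtain ⟨D', h1, h2⟩ := ps_density_pullback H.subtype
      (n := fun g => psNorm fH (φ g)) (by simpa using hN0)
      (fun x y => by simpa using psNorm_sub hnn (φ x) (φ y)) κ hκ D hDκ hD
    refine ⟨D', h1, fun x ε hε => ?_⟩
    obtain ⟨y, hy, hlt⟩ := h2 x ε hε
    refine ⟨y, hy, ?_⟩
    rw [← hext]
    exact hlt
end
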